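/- arXiv:1504.06143 — 2 statements merged into one kernel-verified Lean document; each statement's English description precedes it below -/
import Mathlib

section
/- Expansivity of unital channels for p < 1: Let f ∈ M_d be positive semidefinite and let p < 1, p ≠ 0 (if p < 0, assume f is positive definite). Let T : M_d → M_d be a unital quantum channel, i.e. a completely positive trace-preserving linear map with T(I) = I. Then ‖T(f)‖_p ≥ ‖f‖_p. -/
open Matrix
open scoped ComplexOrder

noncomputable section

/-- Apply a real function to a Hermitian matrix via the functional calculus
(junk value `0` on non-Hermitian matrices). -/
def hermFC {ι : Type*} [Fintype ι] [DecidableEq ι] (φ : ℝ → ℝ)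
    (f : Matrix ι ι ℂ) : Matrix ι ι ℂ :=
  if hf : f.IsHermitian then
    (hf.eigenvectorUnitary : Matrix ι ι ℂ) *
      Matrix.diagonal (fun i => (φ (hf.eigenvalues i) : ℂ)) *
      (star hf.eigenvectorUnitary : Matrix ι ι ℂ)
  else 0

/-- Real matrix powers of a Hermitian matrix, via the functional calculus on eigenvalues. -/
def mpow {ι : Type*} [Fintype ι] [DecidableEq ι] (f : Matrix ι ι ℂ) (a : ℝ) :
    Matrix ι ι ℂ :=
  hermFC (fun x => x ^ a) f

/-- The normalized trace `τ(f) = Tr f / d` (real part). -/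
def ntrace {ι : Type*} [Fintype ι] [DecidableEq ι] (f : Matrix ι ι ℂ) : ℝ :=
  (f.trace).re / (Fintype.card ι)

/-- Normalized Schatten p-'norm': `‖f‖_p = ((1/d) Tr |f|^p)^(1/p)` with `|f| = √(f† f)`. -/
def snorm {ι : Type*} [Fintype ι] [DecidableEq ι] (p : ℝ) (f : Matrix ι ι ℂ) : ℝ :=
  (ntrace (mpow (fᴴ * f) (p / 2))) ^ (1 / p)

/-- The entropy `Ent(f) = τ(f ln f) − τ(f) ln τ(f)`. -/
def mEnt {ι : Type*} [Fintype ι] [DecidableEq ι] (f : Matrix ι ι ℂ) : ℝ :=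
  ntrace (hermFC (fun x => x * Real.log x) f) - ntrace f * Real.log (ntrace f)

/-- The Dirichlet form `E_L(f,g) = τ(f L(g))`. -/
def dirichlet {ι : Type*} [Fintype ι] [DecidableEq ι]
    (L : Matrix ι ι ℂ → Matrix ι ι ℂ) (f g : Matrix ι ι ℂ) : ℝ :=
  ntrace (f * L g)

/-- Complete positivity: every matrix extension `id_m ⊗ T` maps PSD matrices to PSD matrices. -/
def IsCompletelyPositive {ι : Type*} [Fintype ι] [DecidableEq ι]
    (T : Matrix ι ι ℂ → Matrix ι ι ℂ) : Prop :=
  ∀ (m : ℕ) (M : Matrix (Fin m × ι) (Fin m × ι) ℂ), M.PosSemidef →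
    (Matrix.of fun p q : Fin m × ι =>
      T (Matrix.of fun i j : ι => M (p.1, i) (q.1, j)) p.2 q.2).PosSemidef

/-- A quantum channel: a linear, completely positive, trace-preserving map. -/
def IsQChannel {ι : Type*} [Fintype ι] [DecidableEq ι]
    (T : Matrix ι ι ℂ → Matrix ι ι ℂ) : Prop :=
  IsLinearMap ℂ T ∧ IsCompletelyPositive T ∧ ∀ f, (T f).trace = f.trace

/-- Reversibility (detailed balance w.r.t. the trace): `τ(f T(g)) = τ(T(f) g)`. -/
def IsReversible {ι : Type*} [Fintype ι] [DecidableEq ι]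
    (T : Matrix ι ι ℂ → Matrix ι ι ℂ) : Prop :=
  ∀ f g : Matrix ι ι ℂ, (f * T g).trace = (T f * g).trace

/-- Primitivity: iterates of `T` converge on every density matrix to a fixed
full-rank state independent of the input. -/
def IsPrimitive {ι : Type*} [Fintype ι] [DecidableEq ι]
    (T : Matrix ι ι ℂ → Matrix ι ι ℂ) : Prop :=
  ∃ σ : Matrix ι ι ℂ, σ.PosDef ∧ σ.trace = 1 ∧
    ∀ ρ : Matrix ι ι ℂ, ρ.PosSemidef → ρ.trace = 1 →
      Filter.Tendsto (fun k => T^[k] ρ) Filter.atTop (nhds σ)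

/-- The depolarizing channel with parameter `γ` applied to the `k`-th qubit of `n` qubits:
`D_γ(f) = γ f + (1−γ) (tr_k f) ⊗_k (I/2)`. -/
def depolAt {n : ℕ} (γ : ℝ) (k : Fin n)
    (f : Matrix (Fin n → Fin 2) (Fin n → Fin 2) ℂ) :
    Matrix (Fin n → Fin 2) (Fin n → Fin 2) ℂ :=
  Matrix.of fun x y =>
    (γ : ℂ) * f x y +
      ((1 - γ : ℝ) : ℂ) *
        (if x k = y k then
          (1 / 2) * ∑ b : Fin 2, f (Function.update x k b) (Function.update y k b)
        else 0)

/-- The tensor power `D_γ^{⊗n}` of the qubit depolarizing channel, acting on `n` qubits. -/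
def depolChannel {n : ℕ} (γ : ℝ)
    (f : Matrix (Fin n → Fin 2) (Fin n → Fin 2) ℂ) :
    Matrix (Fin n → Fin 2) (Fin n → Fin 2) ℂ :=
  (List.finRange n).foldl (fun g k => depolAt γ k g) f

/-- The semigroup element `e^{−tL}` applied to `f`, defined by its power series. -/
def opExp {ι : Type*} [Fintype ι] [DecidableEq ι]
    (L : Matrix ι ι ℂ → Matrix ι ι ℂ) (t : ℝ) (f : Matrix ι ι ℂ) : Matrix ι ι ℂ :=
  ∑' k : ℕ, (((-t) ^ k / (Nat.factorial k) : ℝ) : ℂ) • L^[k] f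

/-- The classical noise operator `T_γ` on functions on the boolean cube:
each bit is flipped independently with probability `(1−γ)/2`. -/
def noiseOp {n : ℕ} (γ : ℝ) (f : (Fin n → Fin 2) → ℝ) : (Fin n → Fin 2) → ℝ :=
  fun x => ∑ y : Fin n → Fin 2,
    (∏ i : Fin n, if y i = x i then (1 + γ) / 2 else (1 - γ) / 2) * f y

/-- The normalized `ℓ_p` 'norm' `‖f‖_p = (2^{-n} Σ_x |f(x)|^p)^{1/p}` on the boolean cube. -/
def lpnorm {n : ℕ} (p : ℝ) (f : (Fin n → Fin 2) → ℝ) : ℝ :=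
  ((∑ x : Fin n → Fin 2, |f x| ^ p) / 2 ^ n) ^ (1 / p)

end

lemma hermFC_eq_cfc {ι : Type*} [Fintype ι] [DecidableEq ι] (φ : ℝ → ℝ)
    {f : Matrix ι ι ℂ} (hf : f.IsHermitian) : hermFC φ f = cfc φ f := by
  rw [hf.cfc_eq, hermFC, dif_pos hf, Matrix.IsHermitian.cfc, Unitary.conjStarAlgAut_apply]
  rfl

lemma ntrace_cfc {ι : Type*} [Fintype ι] [DecidableEq ι] (φ : ℝ → ℝ)
    {f : Matrix ι ι ℂ} (hf : f.IsHermitian) :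
    ntrace (cfc φ f) = (∑ i, φ (hf.eigenvalues i)) / Fintype.card ι := by
  rw [ntrace, hf.cfc_eq, Matrix.IsHermitian.cfc, Unitary.conjStarAlgAut_apply,
    Matrix.trace_mul_cycle, Unitary.coe_star_mul_self, one_mul, Matrix.trace_diagonal,
    Complex.re_sum]
  rfl

lemma snorm_eq_sum_eigenvalues {ι : Type*} [Fintype ι] [DecidableEq ι] (p : ℝ)
    {f : Matrix ι ι ℂ} (hf : f.PosSemidef) :
    snorm p f = ((∑ i, hf.1.eigenvalues i ^ p) / Fintype.card ι) ^ (1 / p) := by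
  have hfin : (spectrum ℝ f).Finite := Matrix.finite_real_spectrum
  have hcont : ContinuousOn (fun x : ℝ => x ^ (p / 2)) ((fun x : ℝ => x ^ 2) '' spectrum ℝ f) :=
    (hfin.image _).continuousOn _
  have hcfc : cfc (fun x : ℝ => x ^ (p / 2)) (f ^ 2) = cfc (fun x : ℝ => (x ^ 2) ^ (p / 2)) f :=
    (cfc_comp_pow (fun x : ℝ => x ^ (p / 2)) 2 f hcont hf.1).symm
  rw [snorm, mpow, hermFC_eq_cfc _ (Matrix.isHermitian_conjTranspose_mul_self f), hf.1.eq,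
    ← pow_two, hcfc, ntrace_cfc _ hf.1]
  congr 3 with i
  rw [← Real.rpow_natCast, ← Real.rpow_mul (hf.eigenvalues_nonneg i)]
  congr 1
  push_cast
  ring

lemma IsCompletelyPositive.map_posSemidef {ι : Type*} [Fintype ι] [DecidableEq ι]
    {T : Matrix ι ι ℂ → Matrix ι ι ℂ} (hT : IsCompletelyPositive T)
    {f : Matrix ι ι ℂ} (hf : f.PosSemidef) : (T f).PosSemidef :=
  (hT 1 _ (hf.submatrix (Prod.snd : Fin 1 × ι → ι))).submatrix (fun i : ι => ((0 : Fin 1), i))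

/-- A unital positive trace-preserving map acts on spectra by a doubly stochastic matrix. -/
lemma exists_doublyStochastic_mulVec_eigenvalues {ι : Type*} [Fintype ι] [DecidableEq ι]
    {T : Matrix ι ι ℂ → Matrix ι ι ℂ} (hlin : IsLinearMap ℂ T)
    (hpos : ∀ g : Matrix ι ι ℂ, g.PosSemidef → (T g).PosSemidef)
    (htr : ∀ g, (T g).trace = g.trace) (hone : T 1 = 1)
    {f : Matrix ι ι ℂ} (hf : f.IsHermitian) (hTf : (T f).IsHermitian) :
    ∃ D ∈ doublyStochastic ℝ ι, hTf.eigenvalues = D *ᵥ hf.eigenvalues := by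
  set U := hf.eigenvectorUnitary
  set V := hTf.eigenvectorUnitary
  let P : ι → Matrix ι ι ℂ := fun j =>
    (U : Matrix ι ι ℂ) * Matrix.single j j 1 * (star U : Matrix ι ι ℂ)
  let L : Matrix ι ι ℂ →ₗ[ℂ] Matrix ι ι ℂ := hlin.mk' T
  let Q : ι → Matrix ι ι ℂ := fun j => (star V : Matrix ι ι ℂ) * L (P j) * (V : Matrix ι ι ℂ)
  have hPpos (j : ι) : (P j).PosSemidef := by
    have hs : (Matrix.single j j (1 : ℂ)).PosSemidef := by
      rw [← Matrix.diagonal_single]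
      exact Matrix.PosSemidef.diagonal (by simp)
    exact hs.mul_mul_conjTranspose_same _
  have hQpos (j : ι) : (Q j).PosSemidef := (hpos _ (hPpos j)).conjTranspose_mul_mul_same _
  have hQtr (j : ι) : (Q j).trace = 1 := by
    change ((star V : Matrix ι ι ℂ) * T (P j) * (V : Matrix ι ι ℂ)).trace = 1
    rw [Matrix.trace_mul_cycle, Unitary.mul_star_self_of_mem V.2, one_mul, htr,
      Matrix.trace_mul_cycle, Unitary.coe_star_mul_self, one_mul, Matrix.trace_single_eq_same]
  have hQsum (c : ι → ℂ) : ∑ j, c j • Q j = (star V : Matrix ι ι ℂ) *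
      T ((U : Matrix ι ι ℂ) * Matrix.diagonal c * (star U : Matrix ι ι ℂ)) *
        (V : Matrix ι ι ℂ) := by
    change _ = (star V : Matrix ι ι ℂ) *
      L ((U : Matrix ι ι ℂ) * Matrix.diagonal c * (star U : Matrix ι ι ℂ)) * (V : Matrix ι ι ℂ)
    have hd : Matrix.diagonal c = ∑ j, c j • Matrix.single j j (1 : ℂ) := by
      simp [Matrix.smul_single, Matrix.sum_single_eq_diagonal]
    simp only [hd, Matrix.mul_sum, Matrix.sum_mul, map_sum, Matrix.mul_smul, Matrix.smul_mul,
      map_smul, Q, P]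
  refine ⟨Matrix.of fun i j => (Q j i i).re, mem_doublyStochastic_iff_sum.2 ⟨?_, ?_, ?_⟩, ?_⟩
  · exact fun i j => (Complex.nonneg_iff.1 (hQpos j).diag_nonneg).1
  · intro i
    have h := congrFun (congrFun (hQsum 1) i) i
    have h1 : Matrix.diagonal (1 : ι → ℂ) = 1 := Matrix.diagonal_one
    rw [h1, mul_one, Unitary.mul_star_self_of_mem U.2, hone, mul_one,
      Unitary.star_mul_self_of_mem V.2, Matrix.one_apply_eq, Matrix.sum_apply] at h
    simpa using congrArg Complex.re h
  · intro j
    simpa [Matrix.trace] using congrArg Complex.re (hQtr j)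
  · ext i
    have h := congrFun (congrFun (hQsum (RCLike.ofReal ∘ hf.eigenvalues)) i) i
    have hdiag := hTf.conjStarAlgAut_star_eigenvectorUnitary
    rw [Unitary.conjStarAlgAut_star_apply] at hdiag
    have hspec := hf.spectral_theorem
    rw [Unitary.conjStarAlgAut_apply] at hspec
    rw [← hspec, hdiag, Matrix.sum_apply] at h
    simpa [Matrix.mulVec, dotProduct, mul_comm] using (congrArg Complex.re h).symm

lemma ConvexOn.sum_doublyStochastic_mulVec_le {ι : Type*} [Fintype ι] [DecidableEq ι]
    {s : Set ℝ} {φ : ℝ → ℝ} (hφ : ConvexOn ℝ s φ) {D : Matrix ι ι ℝ}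
    (hD : D ∈ doublyStochastic ℝ ι) {x : ι → ℝ} (hx : ∀ i, x i ∈ s) :
    ∑ i, φ ((D *ᵥ x) i) ≤ ∑ i, φ (x i) := by
  obtain ⟨h0, hrow, hcol⟩ := mem_doublyStochastic_iff_sum.1 hD
  calc ∑ i, φ ((D *ᵥ x) i) ≤ ∑ i, ∑ j, D i j * φ (x j) :=
        Finset.sum_le_sum fun i _ =>
          hφ.map_sum_le (fun j _ => h0 i j) (hrow i) fun j _ => hx j
    _ = ∑ j, φ (x j) := by
        rw [Finset.sum_comm]
        simp [← Finset.sum_mul, hcol]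

lemma ConcaveOn.le_sum_doublyStochastic_mulVec {ι : Type*} [Fintype ι] [DecidableEq ι]
    {s : Set ℝ} {φ : ℝ → ℝ} (hφ : ConcaveOn ℝ s φ) {D : Matrix ι ι ℝ}
    (hD : D ∈ doublyStochastic ℝ ι) {x : ι → ℝ} (hx : ∀ i, x i ∈ s) :
    ∑ i, φ (x i) ≤ ∑ i, φ ((D *ᵥ x) i) := by
  simpa using hφ.neg.sum_doublyStochastic_mulVec_le hD hx

lemma convexOn_rpow_of_nonpos {p : ℝ} (hp : p ≤ 0) :
    ConvexOn ℝ (Set.Ioi 0) fun x : ℝ => x ^ p := by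
  have hlog : ConvexOn ℝ (Set.Ioi 0) fun x : ℝ => p * Real.log x := by
    simpa [Pi.neg_def] using (strictConcaveOn_log_Ioi.concaveOn.smul (neg_nonneg.2 hp)).neg
  refine ((convexOn_exp.subset (Set.subset_univ _) ?_).comp hlog
    (Real.exp_monotone.monotoneOn _)).congr fun x hx => ?_
  · exact ((convex_Ioi (0 : ℝ)).isPreconnected.image _
      (continuousOn_const.mul (Real.continuousOn_log.mono
        fun x hx => (Set.mem_Ioi.1 hx).ne'))).ordConnected.convex
  · simp [Real.rpow_def_of_pos (Set.mem_Ioi.1 hx), mul_comm]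

/-- A doubly stochastic matrix maps positive vectors to positive vectors. -/
lemma doublyStochastic_mulVec_pos {ι : Type*} [Fintype ι] [DecidableEq ι] {D : Matrix ι ι ℝ}
    (hD : D ∈ doublyStochastic ℝ ι) {x : ι → ℝ} (hx : ∀ i, 0 < x i) (i : ι) :
    0 < (D *ᵥ x) i := by
  obtain ⟨h0, hrow, -⟩ := mem_doublyStochastic_iff_sum.1 hD
  exact (convex_Ioi (0 : ℝ)).sum_mem (fun j _ => h0 i j) (hrow i) fun j _ => hx j

/-- Expansivity of unital quantum channels for `p < 1`. -/
theorem unital_channel_expansive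
    (d : ℕ) (hd : 0 < d)
    (f : Matrix (Fin d) (Fin d) ℂ) (hf : f.PosSemidef)
    (p : ℝ) (hp : p < 1) (hp0 : p ≠ 0) (hfd : p < 0 → f.PosDef)
    (T : Matrix (Fin d) (Fin d) ℂ → Matrix (Fin d) (Fin d) ℂ)
    (hT : IsQChannel T) (hTu : T 1 = 1) :
    snorm p f ≤ snorm p (T f) := by
  obtain ⟨hlin, hcp, htr⟩ := hT
  have hTf : (T f).PosSemidef := hcp.map_posSemidef hf
  obtain ⟨D, hD, hDf⟩ := exists_doublyStochastic_mulVec_eigenvalues hlin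
    (fun _ => hcp.map_posSemidef) htr hTu hf.1 hTf.1
  rw [snorm_eq_sum_eigenvalues p hf, snorm_eq_sum_eigenvalues p hTf, hDf]
  rcases lt_or_gt_of_ne hp0 with hneg | hpos
  · have : Nonempty (Fin d) := ⟨⟨0, hd⟩⟩
    have hev : ∀ i, 0 < hf.1.eigenvalues i := (hfd hneg).eigenvalues_pos
    refine Real.rpow_le_rpow_of_nonpos (div_pos (Finset.sum_pos (fun i _ => ?_)
      Finset.univ_nonempty) (by simpa using hd)) ?_ (one_div_nonpos.2 hneg.le)
    · exact Real.rpow_pos_of_pos (doublyStochastic_mulVec_pos hD hev i) p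
    · refine div_le_div_of_nonneg_right ?_ (Nat.cast_nonneg _)
      exact (convexOn_rpow_of_nonpos hneg.le).sum_doublyStochastic_mulVec_le hD hev
  · have hev : ∀ i, 0 ≤ hf.1.eigenvalues i := hf.eigenvalues_nonneg
    refine Real.rpow_le_rpow (div_nonneg (Finset.sum_nonneg fun i _ =>
      Real.rpow_nonneg (hev i) p) (Nat.cast_nonneg _)) ?_ (one_div_nonneg.2 hpos.le)
    refine div_le_div_of_nonneg_right ?_ (Nat.cast_nonneg _)
    exact (Real.concaveOn_rpow hpos.le hp.le).le_sum_doublyStochastic_mulVec hD hev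
end

section
/- Quantum Gross's lemma for p ∈ (0,2]: Let T : M_d → M_d be a unital, reversible, primitive quantum channel, let c₀ > 0, and let L = c₀(id − T). Then for every p ∈ (0,2] with p ≠ 1 and every positive semidefinite f ∈ M_d (positive definite where negative matrix powers are required), E_L(f^{p/2}, f^{p/2}) ≤ (p²/(4(p−1))) · E_L(f^{p−1}, f). -/
open Matrix
open scoped ComplexOrder

/-- The Stroock–Varopoulos inequality for two points. -/
theorem sq_rpow_half_sub_le {p x y : ℝ} (hp0 : 0 < p) (hp1 : p ≠ 1) (hx : 0 ≤ x) (hy : 0 ≤ y)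
    (hpos : p < 1 → 0 < x ∧ 0 < y) :
    (x ^ (p / 2) - y ^ (p / 2)) * (x ^ (p / 2) - y ^ (p / 2)) ≤
      p ^ 2 / (4 * (p - 1)) * ((x ^ (p - 1) - y ^ (p - 1)) * (x - y)) := by
  wlog hyx : y ≤ x generalizing x y
  · have h := this hy hx (fun h => (hpos h).symm) (le_of_not_ge hyx)
    nlinarith [h]
  rcases hyx.eq_or_lt with rfl | hlt
  · simp
  have hp1' : p - 1 ≠ 0 := sub_ne_zero.mpr hp1
  have key : ∀ c : ℝ, 0 ≤ (x ^ (p - 1) - y ^ (p - 1)) / (p - 1)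
      - 2 * c * (2 / p * (x ^ (p / 2) - y ^ (p / 2))) + c ^ 2 * (x - y) := by
    intro c
    have hcont (a : ℝ) (ha : a < 0 → p < 1) :
        ContinuousOn (fun t : ℝ => t ^ a) (Set.Icc y x) := by
      intro t ht
      refine (Real.continuousAt_rpow_const t a ?_).continuousWithinAt
      by_cases h : p < 1
      · exact Or.inl ((hpos h).2.trans_le ht.1).ne'
      · exact Or.inr (not_lt.mp fun ha' => h (ha ha'))
    have hmono : MonotoneOn (fun t : ℝ => t ^ (p - 1) / (p - 1)
        - 2 * c * (2 / p * t ^ (p / 2)) + c ^ 2 * t) (Set.Icc y x) := by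
      have hd : ∀ t ∈ interior (Set.Icc y x), HasDerivAt (fun t : ℝ => t ^ (p - 1) / (p - 1)
          - 2 * c * (2 / p * t ^ (p / 2)) + c ^ 2 * t) ((t ^ (p / 2 - 1) - c) ^ 2) t := by
        intro t ht
        rw [interior_Icc] at ht
        have ht0 : 0 < t := hy.trans_lt ht.1
        have h1 := (Real.hasDerivAt_rpow_const (p := p - 1) (Or.inl ht0.ne')).div_const (p - 1)
        have h2 := ((Real.hasDerivAt_rpow_const (p := p / 2)
          (Or.inl ht0.ne')).const_mul (2 / p)).const_mul (2 * c)
        have h3 := (hasDerivAt_id t).const_mul (c ^ 2)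
        refine ((h1.sub h2).add h3).congr_deriv ?_
        have hsq : t ^ (p - 1 - 1) = t ^ (p / 2 - 1) * t ^ (p / 2 - 1) := by
          rw [← Real.rpow_add ht0]; congr 1; ring
        rw [hsq]
        field_simp
        ring
      refine monotoneOn_of_deriv_nonneg (convex_Icc y x) ?_
        (fun t ht => (hd t ht).differentiableAt.differentiableWithinAt)
        (fun t ht => (hd t ht).deriv ▸ sq_nonneg _)
      have c1 := hcont (p - 1) (fun h => by linarith)
      have c2 := hcont (p / 2) (fun h => by linarith)
      fun_prop
    have h := hmono (Set.left_mem_Icc.mpr hyx) (Set.right_mem_Icc.mpr hyx) hyx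
    simp only at h
    rw [sub_div]
    linarith
  have hxy : 0 < x - y := sub_pos.mpr hlt
  have h := key (2 / p * (x ^ (p / 2) - y ^ (p / 2)) / (x - y))
  generalize x ^ (p / 2) - y ^ (p / 2) = B at h ⊢
  generalize x ^ (p - 1) - y ^ (p - 1) = A at h ⊢
  have h4 := mul_nonneg (mul_nonneg h hxy.le) (sq_nonneg (p / 2))
  refine sub_nonneg.mp (h4.trans_eq ?_)
  field_simp
  ring

open Finset in
theorem dirichlet_sum_eq {ι : Type*} [Fintype ι] [DecidableEq ι] (b : ι → ι → ℝ)
    (hsymm : ∀ i j, b i j = b j i) (hrow : ∀ i, ∑ j, b i j = 1) (φ ψ : ι → ℝ) :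
    ∑ i, φ i * ψ i - ∑ i, ∑ j, φ i * ψ j * b i j =
      1 / 2 * ∑ i, ∑ j, b i j * ((φ i - φ j) * (ψ i - ψ j)) := by
  have h1 : ∑ i, ∑ j, b i j * (φ i * ψ i) = ∑ i, φ i * ψ i := by
    simp [← sum_mul, hrow]
  have h2 : ∑ i, ∑ j, b i j * (φ j * ψ j) = ∑ i, φ i * ψ i := by
    rw [sum_comm, ← h1]
    simp only [hsymm]
  have h3 : ∑ i, ∑ j, b i j * (φ j * ψ i) = ∑ i, ∑ j, φ i * ψ j * b i j := by
    rw [sum_comm]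
    refine sum_congr rfl fun i _ => sum_congr rfl fun j _ => ?_
    rw [hsymm]; ring
  have h4 : ∑ i, ∑ j, b i j * (φ i * ψ j) = ∑ i, ∑ j, φ i * ψ j * b i j := by
    simp only [mul_comm]
  have h5 : ∑ i, ∑ j, b i j * ((φ i - φ j) * (ψ i - ψ j)) =
      ∑ i, ∑ j, b i j * (φ i * ψ i) + ∑ i, ∑ j, b i j * (φ j * ψ j)
      - ∑ i, ∑ j, b i j * (φ j * ψ i) - ∑ i, ∑ j, b i j * (φ i * ψ j) := by
    simp only [← sum_add_distrib, ← sum_sub_distrib]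
    refine sum_congr rfl fun i _ => sum_congr rfl fun j _ => ?_
    ring
  rw [h5, h1, h2, h3, h4]
  ring

/-- The rank-one projection onto the `i`-th column of a unitary matrix. -/
noncomputable def colProj {ι : Type*} [Fintype ι] [DecidableEq ι] (U : Matrix.unitaryGroup ι ℂ) (i : ι) :
    Matrix ι ι ℂ :=
  (U : Matrix ι ι ℂ) * Matrix.single i i 1 * (star U : Matrix ι ι ℂ)

section colProj

variable {ι : Type*} [Fintype ι] [DecidableEq ι] (U : Matrix.unitaryGroup ι ℂ)

theorem conj_diagonal_eq_sum_colProj (φ : ι → ℝ) :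
    (U : Matrix ι ι ℂ) * Matrix.diagonal (fun i => (φ i : ℂ)) * (star U : Matrix ι ι ℂ) =
      ∑ i, (φ i : ℂ) • colProj U i := by
  have h : Matrix.diagonal (fun i => (φ i : ℂ)) =
      ∑ i, (φ i : ℂ) • Matrix.single i i (1 : ℂ) := by
    simp [Matrix.smul_single, Matrix.sum_single_eq_diagonal]
  rw [h, Matrix.mul_sum, Matrix.sum_mul]
  simp only [colProj, Matrix.mul_smul, Matrix.smul_mul]

theorem sum_colProj : ∑ i, colProj U i = 1 := by
  have h := conj_diagonal_eq_sum_colProj U (fun _ => 1)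
  simpa using h.symm

theorem colProj_mul_trace (i : ι) (X : Matrix ι ι ℂ) :
    (colProj U i * X).trace = ((star U : Matrix ι ι ℂ) * X * (U : Matrix ι ι ℂ)) i i := by
  rw [colProj, Matrix.mul_assoc, Matrix.mul_assoc, Matrix.trace_mul_comm, Matrix.mul_assoc,
    Matrix.trace_single_mul]
  simp [Matrix.mul_assoc]

theorem colProj_mul_colProj_trace (i j : ι) :
    (colProj U i * colProj U j).trace = if i = j then 1 else 0 := by
  have h : (star U : Matrix ι ι ℂ) * (U : Matrix ι ι ℂ) = 1 := Unitary.coe_star_mul_self U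
  rw [colProj_mul_trace, colProj]
  have : (star U : Matrix ι ι ℂ) * ((U : Matrix ι ι ℂ) * Matrix.single j j 1 *
      (star U : Matrix ι ι ℂ)) * (U : Matrix ι ι ℂ) = Matrix.single j j 1 := by
    calc _ = ((star U : Matrix ι ι ℂ) * (U : Matrix ι ι ℂ)) * Matrix.single j j 1 *
        ((star U : Matrix ι ι ℂ) * (U : Matrix ι ι ℂ)) := by simp only [Matrix.mul_assoc]
      _ = _ := by rw [h]; simp
  rw [this]
  simp [Matrix.single_apply, eq_comm]

theorem colProj_posSemidef (i : ι) : (colProj U i).PosSemidef := by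
  have h : (Matrix.single i i (1 : ℂ)).PosSemidef := by
    rw [← Matrix.diagonal_single]
    exact Matrix.PosSemidef.diagonal (Pi.single_nonneg.mpr zero_le_one)
  exact h.mul_mul_conjTranspose_same (U : Matrix ι ι ℂ)

theorem colProj_mul_trace_re_nonneg (i : ι) {X : Matrix ι ι ℂ} (hX : X.PosSemidef) :
    0 ≤ (colProj U i * X).trace.re := by
  rw [colProj_mul_trace]
  exact (Complex.le_def.mp
    ((hX.conjTranspose_mul_mul_same (U : Matrix ι ι ℂ)).diag_nonneg (i := i))).1

end colProj

theorem IsCompletelyPositive.posSemidef {ι : Type*} [Fintype ι] [DecidableEq ι]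
    {T : Matrix ι ι ℂ → Matrix ι ι ℂ} (hT : IsCompletelyPositive T) {X : Matrix ι ι ℂ}
    (hX : X.PosSemidef) : (T X).PosSemidef :=
  (hT 1 (X.submatrix Prod.snd Prod.snd) (hX.submatrix _)).submatrix (fun i => ((0 : Fin 1), i))

theorem dirichlet_sum_colProj {ι : Type*} [Fintype ι] [DecidableEq ι]
    {T : Matrix ι ι ℂ → Matrix ι ι ℂ} (hT : IsLinearMap ℂ T) (hTu : T 1 = 1)
    (hTrev : IsReversible T) (U : Matrix.unitaryGroup ι ℂ) (c₀ : ℝ) (φ ψ : ι → ℝ) :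
    dirichlet (fun g => (c₀ : ℂ) • (g - T g)) (∑ i, (φ i : ℂ) • colProj U i)
        (∑ i, (ψ i : ℂ) • colProj U i) =
      c₀ / (2 * Fintype.card ι) * ∑ i, ∑ j, (colProj U i * T (colProj U j)).trace.re *
        ((φ i - φ j) * (ψ i - ψ j)) := by
  have hbil (G : ι → Matrix ι ι ℂ) : ((∑ i, (φ i : ℂ) • colProj U i) *
      ∑ j, (ψ j : ℂ) • G j).trace.re =
      ∑ i, ∑ j, φ i * ψ j * (colProj U i * G j).trace.re := by
    simp only [Finset.sum_mul, Finset.mul_sum, Matrix.smul_mul, Matrix.mul_smul,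
      Matrix.trace_sum, Matrix.trace_smul, Complex.re_sum, smul_eq_mul, Complex.re_ofReal_mul,
      mul_assoc]
    rw [Finset.sum_comm]
    simp only [mul_left_comm]
  have hTsum (g : ι → Matrix ι ι ℂ) : T (∑ j, g j) = ∑ j, T (g j) :=
    map_sum (hT.mk' T) g Finset.univ
  have hTψ : T (∑ j, (ψ j : ℂ) • colProj U j) = ∑ j, (ψ j : ℂ) • T (colProj U j) := by
    rw [hTsum]
    simp only [hT.map_smul]
  have hsymm (i j : ι) : (colProj U i * T (colProj U j)).trace.re =
      (colProj U j * T (colProj U i)).trace.re := by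
    rw [hTrev, Matrix.trace_mul_comm]
  have hrow (i : ι) : ∑ j, (colProj U i * T (colProj U j)).trace.re = 1 := by
    rw [← Complex.re_sum, ← Matrix.trace_sum, ← Matrix.mul_sum, ← hTsum, sum_colProj, hTu,
      ← sum_colProj U, Matrix.mul_sum, Matrix.trace_sum]
    simp [colProj_mul_colProj_trace]
  have hid : ((∑ i, (φ i : ℂ) • colProj U i) * ∑ j, (ψ j : ℂ) • colProj U j).trace.re =
      ∑ i, φ i * ψ i := by
    rw [hbil]
    simp [colProj_mul_colProj_trace, apply_ite Complex.re]
  have hsum := dirichlet_sum_eq _ hsymm hrow φ ψ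
  simp only [dirichlet, ntrace, Matrix.mul_smul, Matrix.trace_smul, smul_eq_mul,
    Complex.re_ofReal_mul, Matrix.mul_sub, Matrix.trace_sub, Complex.sub_re]
  rw [hid, hTψ, hbil, hsum]
  ring

/-- Quantum Gross's lemma for `p ∈ (0,2]`. -/
theorem quantum_gross_lemma
    (d : ℕ) (hd : 0 < d)
    (T : Matrix (Fin d) (Fin d) ℂ → Matrix (Fin d) (Fin d) ℂ)
    (hT : IsQChannel T) (hTu : T 1 = 1) (hTrev : IsReversible T)
    (hTprim : IsPrimitive T)
    (c₀ : ℝ) (hc₀ : 0 < c₀)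
    (L : Matrix (Fin d) (Fin d) ℂ → Matrix (Fin d) (Fin d) ℂ)
    (hL : L = fun g => (c₀ : ℂ) • (g - T g))
    (p : ℝ) (hp0 : 0 < p) (hp2 : p ≤ 2) (hp1 : p ≠ 1)
    (f : Matrix (Fin d) (Fin d) ℂ) (hf : f.PosSemidef) (hfd : p < 1 → f.PosDef) :
    dirichlet L (mpow f (p/2)) (mpow f (p/2)) ≤
      p^2 / (4 * (p - 1)) * dirichlet L (mpow f (p-1)) f := by
  have hpow (a : ℝ) : mpow f a = ∑ i, ((hf.1.eigenvalues i ^ a : ℝ) : ℂ) •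
      colProj hf.1.eigenvectorUnitary i := by
    rw [mpow, hermFC, dif_pos hf.1]
    exact conj_diagonal_eq_sum_colProj _ _
  have hf1 : f = ∑ i, (hf.1.eigenvalues i : ℂ) • colProj hf.1.eigenvectorUnitary i :=
    hf.1.spectral_theorem.trans (conj_diagonal_eq_sum_colProj _ hf.1.eigenvalues)
  have hdir := dirichlet_sum_colProj hT.1 hTu hTrev hf.1.eigenvectorUnitary c₀
  have hnum : dirichlet L (mpow f (p - 1)) f = _ :=
    (congrArg₂ (dirichlet L) (hpow (p - 1)) hf1).trans (hL ▸ hdir _ _)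
  rw [hnum, hpow, hL, hdir, mul_left_comm]
  refine mul_le_mul_of_nonneg_left ?_ (by positivity)
  rw [Finset.mul_sum]
  refine Finset.sum_le_sum fun i _ => ?_
  rw [Finset.mul_sum]
  refine Finset.sum_le_sum fun j _ => ?_
  rw [mul_left_comm (p ^ 2 / (4 * (p - 1)))]
  refine mul_le_mul_of_nonneg_left ?_
    (colProj_mul_trace_re_nonneg _ i (hT.2.1.posSemidef (colProj_posSemidef _ j)))
  exact sq_rpow_half_sub_le hp0 hp1 (hf.eigenvalues_nonneg i) (hf.eigenvalues_nonneg j)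
    fun h => ⟨(hfd h).eigenvalues_pos i, (hfd h).eigenvalues_pos j⟩
end
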